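/- For every number of players p ∈ {2, 3, 4, 5}, every perfect trace of the p-player Hanabi bookkeeping model has length at most (7 + 2·d₀ + p) − (25 − (5 + p)); explicitly, at most 71 for p = 2, at most 63 for p = 3, at most 63 for p = 4, and at most 57 for p = 5. -/

import Mathlib

/-- A state of the Hanabi bookkeeping model:
`m` hint tokens, `d` cards left in the deck, `q` remaining turns once the
deck is empty, `f` completed fireworks, `s` score. -/
structure HState where
  m : ℕ
  d : ℕ
  q : ℕ
  f : ℕ
  s : ℕ

/-- The invariants a state must satisfy. -/
def HState.valid (st : HState) : Prop :=
  st.m ≤ 8 ∧ st.f ≤ 5 ∧ 5 * st.f ≤ st.s ∧ st.s ≤ 20 + st.f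

/-- The possible kinds of turns. -/
inductive HAction where
  | hint | discard | playFail | playSucc | playComplete
deriving DecidableEq

/-- Is the action a play (successful or not, possibly firework-completing)? -/
def HAction.isPlay : HAction → Prop
  | .hint => False
  | .discard => False
  | _ => True

instance : DecidablePred HAction.isPlay := by
  intro a; cases a <;> simp [HAction.isPlay] <;> infer_instance

/-- A turn of kind `a` from state `st` to state `st'`. -/
def Step (a : HAction) (st st' : HState) : Prop :=
  st.valid ∧ st'.valid ∧
  -- a turn is allowed only if the score is below 25 and the game is not over
  st.s < 25 ∧ (1 ≤ st.d ∨ 1 ≤ st.q) ∧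
  -- update of the deck size and of the remaining-turns counter
  st'.d = (if 1 ≤ st.d ∧ a ≠ .hint then st.d - 1 else st.d) ∧
  st'.q = (if st.d = 0 then st.q - 1 else st.q) ∧
  -- effect of the individual actions
  (match a with
  | .hint => 1 ≤ st.m ∧ st'.m = st.m - 1 ∧ st'.f = st.f ∧ st'.s = st.s
  | .discard => st.m ≤ 7 ∧ st'.m = st.m + 1 ∧ st'.f = st.f ∧ st'.s = st.s
  | .playFail => st'.m = st.m ∧ st'.f = st.f ∧ st'.s = st.s
  | .playSucc => st'.m = st.m ∧ st'.f = st.f ∧ st'.s = st.s + 1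
  | .playComplete =>
      st.f ≤ 4 ∧ st'.m = min (st.m + 1) 8 ∧ st'.f = st.f + 1 ∧ st'.s = st.s + 1)

/-- Hand size for `p` players. -/
def handSize (p : ℕ) : ℕ := if p ≤ 3 then 5 else 4

/-- Initial deck size for `p` players. -/
def initialDeck (p : ℕ) : ℕ := 50 - p * handSize p

/-- The initial state for `p` players. -/
def initState (p : ℕ) : HState := ⟨8, initialDeck p, p, 0, 0⟩

/-- A trace of length `n` (i.e. with `n` turns) of the `p`-player Hanabi
bookkeeping model: `n + 1` states starting at the initial state, with
consecutive states related by turns. -/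
structure Trace (p n : ℕ) where
  state : Fin (n + 1) → HState
  action : Fin n → HAction
  init : state 0 = initState p
  step : ∀ t : Fin n, Step (action t) (state t.castSucc) (state t.succ)

/-- A bound on the time `k` at which a state can be reached with `p` players and `D` initial
deck cards: the first alternative holds until the first turn played with an empty deck,
the second one afterwards. -/
def HState.TimeBound (p D k : ℕ) (st : HState) : Prop :=
  (st.q = p ∧ k + st.m + 2 * st.d + st.s ≤ 8 + 2 * D + st.f) ∨
    (st.d = 0 ∧ st.q < p ∧ k + st.s + 2 * st.q ≤ 12 + 2 * D + 2 * p)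

theorem HState.TimeBound.step {p D k : ℕ} {a : HAction} {st st' : HState}
    (h : st.TimeBound p D k) (hs : Step a st st') : st'.TimeBound p D (k + 1) := by
  obtain ⟨⟨_, _, _, _⟩, ⟨_, _, _, _⟩, _, _, hd, hq, ha⟩ := hs
  unfold HState.TimeBound at h ⊢
  cases a <;> simp at hd ha <;> split_ifs at hd hq <;> omega

theorem Trace.timeBound {p n : ℕ} (tr : Trace p n) (t : Fin (n + 1)) :
    (tr.state t).TimeBound p (initialDeck p) t := by
  induction t using Fin.induction with
  | zero =>
    rw [tr.init]
    simp [HState.TimeBound, initState]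
  | succ t ih => simpa using ih.step (tr.step t)

/-- For every number of players `p ∈ {2, 3, 4, 5}`, every perfect trace of the
`p`-player Hanabi bookkeeping model has length at most
`(7 + 2 * d₀ + p) − (25 − (5 + p))`; explicitly, at most 71, 63, 63, 57 for
`p = 2, 3, 4, 5` respectively. -/
theorem hanabi_perfect_max_length (p : ℕ) (hp₂ : 2 ≤ p) (hp₅ : p ≤ 5)
    (n : ℕ) (tr : Trace p n)
    (hperfect : (tr.state (Fin.last n)).s = 25) :
    n ≤ (7 + 2 * initialDeck p + p) - (25 - (5 + p)) ∧
    (p = 2 → n ≤ 71) ∧ (p = 3 → n ≤ 63) ∧ (p = 4 → n ≤ 63) ∧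
    (p = 5 → n ≤ 57) := by
  have hbound := tr.timeBound (Fin.last n)
  have hf : (tr.state (Fin.last n)).f ≤ 5 := by
    induction Fin.last n using Fin.cases with
    | zero => simp [tr.init, initState]
    | succ t => exact (tr.step t).2.1.2.1
  simp only [HState.TimeBound, hperfect, Fin.val_last] at hbound
  interval_cases p <;> simp [initialDeck, handSize] at hbound ⊢ <;> omega
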